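/- Let d ≥ 2, t > 0, and let μ be a compactly supported Borel probability measure on ℝ^d with μ(B(x,r)) ≤ C r^s for all x and r > 0, where s > (d+1)/2. For ε ∈ (0,1) define recursively μ_0^ε = μ and dμ_{k+1}^ε(x) = (σ_t^ε * μ_k^ε)(x) dμ(x) for k ≥ 0. Then for every α with d − s < α < d and every k ≥ 0 there is a constant C(k), independent of ε ∈ (0,1), such that ∫_{ℝ^d} |\widehat{μ_k^ε}(ξ)|² |ξ|^{−α} dξ ≤ C(k). -/

import Mathlib

open MeasureTheory Set Metric
open scoped ENNReal RealInnerProductSpace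

/-- The surface measure `σ_t` on the sphere of radius `t` in `ℝ^d`, realized as the
`(d-1)`-dimensional Hausdorff measure restricted to the sphere. -/
noncomputable def sphereMeasure (d : ℕ) (t : ℝ) : Measure (EuclideanSpace ℝ (Fin d)) :=
  (MeasureTheory.Measure.hausdorffMeasure ((d : ℝ) - 1)).restrict
    (Metric.sphere (0 : EuclideanSpace ℝ (Fin d)) t)

/-- The mollified surface measure `σ_t^ε = σ_t * ρ_ε`, where `ρ_ε(x) = ε^{-d} ρ(x/ε)`. -/
noncomputable def mollifiedSphere (d : ℕ) (t ε : ℝ) (ρ : EuclideanSpace ℝ (Fin d) → ℝ)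
    (x : EuclideanSpace ℝ (Fin d)) : ℝ :=
  ∫ y, (ε ^ d)⁻¹ * ρ (ε⁻¹ • (x - y)) ∂(sphereMeasure d t)

/-- The recursively defined measures `μ_0 = μ`, `dμ_{k+1}(x) = (g * μ_k)(x) dμ(x)`, where
`g * ν` denotes the convolution of a function `g` with a measure `ν`. -/
noncomputable def chainMeasure {d : ℕ} (μ : Measure (EuclideanSpace ℝ (Fin d)))
    (g : EuclideanSpace ℝ (Fin d) → ℝ) : ℕ → Measure (EuclideanSpace ℝ (Fin d))
  | 0 => μ
  | k + 1 => μ.withDensity fun x => ENNReal.ofReal (∫ y, g (x - y) ∂(chainMeasure μ g k))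

/-- The Fourier transform `ν̂(ξ) = ∫ e^{-2πi x·ξ} dν(x)` of a measure on `ℝ^d`. -/
noncomputable def fourierMeasure {d : ℕ} (ν : Measure (EuclideanSpace ℝ (Fin d)))
    (ξ : EuclideanSpace ℝ (Fin d)) : ℂ :=
  ∫ x, Complex.exp (-(2 * Real.pi * ⟪x, ξ⟫) * Complex.I) ∂ν

/-- On the part of a sphere where one coordinate stays away from `0` in absolute value,
dropping this coordinate is bi-Lipschitz. -/
lemma hausdorffMeasure_sphere_cap_lt_top {n : ℕ} (t δ c : ℝ) (hδ : 0 < δ)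
    (i : Fin (n + 1)) (hc : c ^ 2 = 1) :
    Measure.hausdorffMeasure (X := EuclideanSpace ℝ (Fin (n + 1))) (n : ℝ)
      {y | ‖y‖ = t ∧ δ ≤ c * y i} < ∞ := by
  set S : Set (EuclideanSpace ℝ (Fin (n + 1))) := {y | ‖y‖ = t ∧ δ ≤ c * y i} with hS
  let P : EuclideanSpace ℝ (Fin (n + 1)) → (Fin n → ℝ) := fun y j => y (i.succAbove j)
  have hsum : ∀ y : EuclideanSpace ℝ (Fin (n + 1)), y ∈ S → y i ^ 2 + ∑ j, P y j ^ 2 = t ^ 2 := by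
    intro y hy
    rw [← hy.1, EuclideanSpace.real_norm_sq_eq, Fin.sum_univ_succAbove _ i]
  have ht : ∀ y : EuclideanSpace ℝ (Fin (n + 1)), y ∈ S → ∀ j, |P y j| ≤ |t| := by
    intro y hy j
    rw [← sq_le_sq, ← hsum y hy]
    have := Finset.single_le_sum (f := fun j => P y j ^ 2) (fun j _ => sq_nonneg _)
      (Finset.mem_univ j)
    nlinarith [sq_nonneg (y i)]
  let M : ℝ := n * (|t| / δ) + n
  have hM : 0 ≤ M := by positivity
  have key : ∀ y ∈ S, ∀ z ∈ S, dist y z ≤ M * dist (P y) (P z) := by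
    intro y hy z hz
    set D := dist (P y) (P z)
    have hD0 : 0 ≤ D := dist_nonneg
    have hD : ∀ j, |P y j - P z j| ≤ D := fun j => by
      rw [← Real.dist_eq]; exact dist_le_pi_dist _ _ _
    have h1 : |y i - z i| ≤ n * (|t| / δ) * D := by
      have e : (y i - z i) * (y i + z i) = ∑ j, (P z j - P y j) * (P z j + P y j) := by
        have := hsum y hy
        have := hsum z hz
        have : ∑ j, (P z j - P y j) * (P z j + P y j) = ∑ j, P z j ^ 2 - ∑ j, P y j ^ 2 := by
          rw [← Finset.sum_sub_distrib]; congr 1; ext; ring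
        rw [this]; linarith
      have e2 : |y i - z i| * |y i + z i| ≤ n * (D * (2 * |t|)) := by
        rw [← abs_mul, e]
        refine (Finset.abs_sum_le_sum_abs _ _).trans ?_
        calc _ ≤ ∑ j : Fin n, D * (2 * |t|) := by
              refine Finset.sum_le_sum fun j _ => ?_
              rw [abs_mul]
              refine mul_le_mul ?_ ?_ (abs_nonneg _) hD0
              · rw [abs_sub_comm]; exact hD j
              · refine (abs_add_le _ _).trans ?_
                linarith [ht y hy j, ht z hz j]
          _ = _ := by simp
      have e3 : 2 * δ ≤ |y i + z i| := by
        have hc' : |c| = 1 := by rw [← sq_eq_sq₀ (abs_nonneg _) zero_le_one, sq_abs, hc]; norm_num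
        calc 2 * δ ≤ c * (y i + z i) := by linarith [hy.2, hz.2]
          _ ≤ |c * (y i + z i)| := le_abs_self _
          _ = _ := by rw [abs_mul, hc', one_mul]
      have e4 : |y i - z i| * (2 * δ) ≤ n * (D * (2 * |t|)) :=
        (mul_le_mul_of_nonneg_left e3 (abs_nonneg _)).trans e2
      rw [← mul_le_mul_iff_left₀ (by positivity : 0 < 2 * δ)]
      refine e4.trans (le_of_eq ?_)
      field_simp
    calc dist y z ≤ ∑ k, |y k - z k| := by
          rw [EuclideanSpace.dist_eq]
          refine (Real.sqrt_le_sqrt (Finset.sum_sq_le_sq_sum_of_nonneg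
            fun k _ => dist_nonneg)).trans ?_
          rw [Real.sqrt_sq (Finset.sum_nonneg fun _ _ => dist_nonneg)]
          simp [Real.dist_eq]
      _ = |y i - z i| + ∑ j, |P y j - P z j| := by rw [Fin.sum_univ_succAbove _ i]
      _ ≤ n * (|t| / δ) * D + ∑ j : Fin n, D := by
          gcongr with j; exact hD j
      _ = M * D := by simp [M]; ring
  have hinj : InjOn P S := by
    intro y hy z hz h
    have := key y hy z hz
    rw [h, dist_self, mul_zero] at this
    exact dist_le_zero.1 this
  let g := Function.invFunOn P S
  have hg : ∀ y ∈ S, g (P y) = y := fun y hy => hinj.leftInvOn_invFunOn hy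
  have hlip : LipschitzOnWith (Real.toNNReal M) g (P '' S) := by
    refine LipschitzOnWith.of_dist_le_mul ?_
    rintro _ ⟨y, hy, rfl⟩ _ ⟨z, hz, rfl⟩
    rw [hg y hy, hg z hz, Real.coe_toNNReal _ hM]
    exact key y hy z hz
  have himg : g '' (P '' S) = S := by
    rw [image_image]
    refine (image_congr hg).trans (image_id' S)
  have hle := hlip.hausdorffMeasure_image_le (d := (n : ℝ)) (by positivity)
  rw [himg] at hle
  refine hle.trans_lt (ENNReal.mul_lt_top (by simp) ?_)
  have hvol : (Measure.hausdorffMeasure (n : ℝ) : Measure (Fin n → ℝ)) = volume := by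
    have := hausdorffMeasure_pi_real (ι := Fin n)
    rwa [Fintype.card_fin] at this
  rw [hvol]
  refine (measure_mono ?_).trans_lt (measure_closedBall_lt_top (x := (0 : Fin n → ℝ)) (r := |t|))
  rintro _ ⟨y, hy, rfl⟩
  rw [mem_closedBall, dist_zero_right, pi_norm_le_iff_of_nonneg (abs_nonneg t)]
  exact ht y hy

lemma sphereMeasure_univ_lt_top {d : ℕ} (hd : 1 ≤ d) {t : ℝ} (ht : 0 < t) :
    sphereMeasure d t univ < ∞ := by
  obtain ⟨n, rfl⟩ : ∃ n, d = n + 1 := ⟨d - 1, by omega⟩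
  rw [sphereMeasure, Measure.restrict_apply_univ]
  have hsub : sphere (0 : EuclideanSpace ℝ (Fin (n + 1))) t ⊆
      ⋃ i : Fin (n + 1), ({y | ‖y‖ = t ∧ t / (n + 1) ≤ 1 * y i} ∪
        {y | ‖y‖ = t ∧ t / (n + 1) ≤ (-1) * y i}) := by
    intro y hy
    have hy : ‖y‖ = t := by simpa using hy
    by_contra hcon
    simp only [mem_iUnion, mem_union, mem_ofPred_eq, not_exists, not_or, not_and, not_le] at hcon
    have habs : ∀ i, |y i| < t / (n + 1) := fun i => by
      have := (hcon i).1 hy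
      have := (hcon i).2 hy
      rw [abs_lt]; constructor <;> linarith
    have : ‖y‖ < t := by
      calc ‖y‖ ≤ ∑ k, |y k| := by
            rw [EuclideanSpace.norm_eq]
            refine (Real.sqrt_le_sqrt (Finset.sum_sq_le_sq_sum_of_nonneg
              fun k _ => norm_nonneg _)).trans ?_
            rw [Real.sqrt_sq (Finset.sum_nonneg fun _ _ => norm_nonneg _)]
            simp
        _ < ∑ k : Fin (n + 1), t / (n + 1) :=
            Finset.sum_lt_sum_of_nonempty Finset.univ_nonempty fun i _ => habs i
        _ = t := by simp; field_simp
    linarith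
  have hn : ((n + 1 : ℕ) : ℝ) - 1 = n := by push_cast; ring
  rw [hn]
  refine (measure_mono hsub).trans_lt ?_
  refine (measure_iUnion_le _).trans_lt ?_
  rw [tsum_fintype]
  refine ENNReal.sum_lt_top.2 fun i _ => (measure_union_le _ _).trans_lt (ENNReal.add_lt_top.2 ?_)
  exact ⟨hausdorffMeasure_sphere_cap_lt_top t _ 1 (by positivity) i (by norm_num),
    hausdorffMeasure_sphere_cap_lt_top t _ (-1) (by positivity) i (by norm_num)⟩

lemma map_sphereMeasure {d : ℕ} (t : ℝ)
    (e : EuclideanSpace ℝ (Fin d) ≃ₗᵢ[ℝ] EuclideanSpace ℝ (Fin d)) :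
    (sphereMeasure d t).map e = sphereMeasure d t := by
  have h := (e.toIsometryEquiv.measurePreserving_hausdorffMeasure ((d : ℝ) - 1)).restrict_preimage
    (s := sphere (0 : EuclideanSpace ℝ (Fin d)) t) isClosed_sphere.measurableSet
  have hpre : e.toIsometryEquiv ⁻¹' sphere (0 : EuclideanSpace ℝ (Fin d)) t = sphere 0 t := by
    ext x; simp
  rw [hpre] at h
  exact h.map_eq

/-- A nonzero measure on `ℝ^d` cannot be Frostman of exponent larger than `d`. -/
lemma exponent_le_of_measure_closedBall_le {d : ℕ} (μ : Measure (EuclideanSpace ℝ (Fin d)))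
    [NeZero μ] {C s : ℝ} (hC : 0 < C) (hs : 0 < s)
    (hball : ∀ (x : EuclideanSpace ℝ (Fin d)) (r : ℝ), 0 < r →
      μ (closedBall x r) ≤ ENNReal.ofReal (C * r ^ s)) : s ≤ d := by
  by_contra! hlt
  have hC0 : ENNReal.ofReal C ≠ 0 := by simpa using hC
  have hle : (ENNReal.ofReal C)⁻¹ • μ ≤ Measure.hausdorffMeasure s := by
    refine Measure.le_hausdorffMeasure s _ 1 one_pos fun A hA => ?_
    rcases A.eq_empty_or_nonempty with rfl | ⟨x, hx⟩
    · simp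
    have hfin : ediam A ≠ ∞ := (hA.trans_lt ENNReal.one_lt_top).ne
    have hr : ∀ r : ℝ, 0 < r → diam A ≤ r → μ A ≤ ENNReal.ofReal (C * r ^ s) := by
      intro r hr hAr
      refine (measure_mono fun y hy => ?_).trans (hball x r hr)
      exact (dist_le_diam_of_mem' hfin hy hx).trans hAr
    have hr' : μ A ≤ ENNReal.ofReal (C * diam A ^ s) := by
      have ht : Filter.Tendsto (fun r : ℝ => ENNReal.ofReal (C * r ^ s))
          (nhdsWithin (diam A) (Ioi (diam A))) (nhds (ENNReal.ofReal (C * diam A ^ s))) := by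
        refine Filter.Tendsto.mono_left ?_ nhdsWithin_le_nhds
        refine (ENNReal.continuous_ofReal.tendsto _).comp ?_
        exact ((Real.continuousAt_rpow_const _ _ (Or.inr hs.le)).const_mul C).tendsto
      refine ge_of_tendsto ht ?_
      filter_upwards [self_mem_nhdsWithin] with r hr0
      exact hr r (diam_nonneg.trans_lt hr0) (le_of_lt hr0)
    rw [Measure.smul_apply, smul_eq_mul, ENNReal.inv_mul_le_iff hC0 ENNReal.ofReal_ne_top]
    refine hr'.trans (le_of_eq ?_)
    rw [ENNReal.ofReal_mul hC.le, ← ENNReal.ofReal_rpow_of_nonneg diam_nonneg hs.le]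
    rw [diam, ENNReal.ofReal_toReal hfin]
  have hz : (Measure.hausdorffMeasure s : Measure (EuclideanSpace ℝ (Fin d))) = 0 := by
    exact Real.hausdorffMeasure_of_finrank_lt (by simpa using hlt)
  rw [hz] at hle
  have := le_antisymm hle (Measure.zero_le _)
  have h0 : μ = 0 := by
    ext A hA
    have h1 := congrArg (fun m => m A) this
    simpa using h1
  exact NeZero.ne μ h0

/-- Solutions of the radial Helmholtz equation decay like `r ^ (-n / 2)`. -/
lemma radial_helmholtz_decay {n : ℕ} {t : ℝ} (ht : 0 < t) {φ φ' : ℝ → ℝ}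
    (h1 : ∀ r, HasDerivAt φ (φ' r) r)
    (h2 : ∀ r, 0 < r → HasDerivAt φ' (-t ^ 2 * φ r - n / r * φ' r) r) :
    ∃ K, ∀ r, 1 ≤ r → φ r ^ 2 * r ^ n ≤ K := by
  set m : ℝ := n / 2 with hm
  set K : ℝ := |m ^ 2 - m| / t with hK
  set p : ℝ → ℝ := fun r => φ' r + m * φ r / r with hp
  set L : ℝ → ℝ := fun r => r ^ n * (p r ^ 2 + t ^ 2 * φ r ^ 2) * Real.exp (K / r) with hL
  have hpd : ∀ r, 0 < r → HasDerivAt p (-(m / r) * p r + (m ^ 2 - m) * φ r / r ^ 2 -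
      t ^ 2 * φ r) r := by
    intro r hr
    have := (h2 r hr).add (((h1 r).const_mul m).div (hasDerivAt_id r) hr.ne')
    refine this.congr_deriv ?_
    simp only [hp, id, hm]
    field_simp
    ring
  have hpow : ∀ r : ℝ, 0 < r → HasDerivAt (fun r : ℝ => r ^ n) (2 * m / r * r ^ n) r := by
    intro r hr
    refine (hasDerivAt_pow n r).congr_deriv ?_
    rcases n with _ | n
    · simp [hm]
    · simp only [hm, Nat.add_sub_cancel]; field_simp; ring
  have hLd : ∀ r, 0 < r → HasDerivAt L (r ^ n * Real.exp (K / r) *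
      (2 * (m ^ 2 - m) * p r * φ r - K * (p r ^ 2 + t ^ 2 * φ r ^ 2)) / r ^ 2) r := by
    intro r hr
    have hQ := ((hpd r hr).pow 2).add (((h1 r).pow 2).const_mul (t ^ 2))
    have hE := ((hasDerivAt_const r K).div (hasDerivAt_id r) hr.ne').exp
    refine (((hpow r hr).mul hQ).mul hE).congr_deriv ?_
    have hφ : φ' r = p r - m * φ r / r := by simp [hp]
    rw [hφ]
    simp only [id, Pi.add_apply, Pi.pow_apply, Pi.mul_apply, Nat.cast_ofNat, Pi.div_apply]
    field_simp
    ring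
  have hneg : ∀ r, 0 < r → r ^ n * Real.exp (K / r) *
      (2 * (m ^ 2 - m) * p r * φ r - K * (p r ^ 2 + t ^ 2 * φ r ^ 2)) / r ^ 2 ≤ 0 := by
    intro r hr
    refine div_nonpos_of_nonpos_of_nonneg (mul_nonpos_of_nonneg_of_nonpos (by positivity) ?_)
      (by positivity)
    have hKt : |m ^ 2 - m| = K * t := by rw [hK]; field_simp
    have hK0 : 0 ≤ K := by positivity
    have ha : 2 * (m ^ 2 - m) * p r * φ r ≤ 2 * (K * t) * (|p r| * |φ r|) := by
      rw [← hKt]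
      calc 2 * (m ^ 2 - m) * p r * φ r ≤ |2 * (m ^ 2 - m) * p r * φ r| := le_abs_self _
        _ = _ := by rw [abs_mul, abs_mul, abs_mul, abs_two]; ring
    have hb : 2 * t * (|p r| * |φ r|) ≤ p r ^ 2 + t ^ 2 * φ r ^ 2 := by
      rw [← sq_abs (p r), ← sq_abs (φ r)]
      nlinarith [sq_nonneg (|p r| - t * |φ r|)]
    nlinarith
  have hanti : AntitoneOn L (Ici 1) := by
    have hd : ∀ r ∈ Ici (1 : ℝ), DifferentiableAt ℝ L r := fun r hr =>
      (hLd r (lt_of_lt_of_le one_pos hr)).differentiableAt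
    refine antitoneOn_of_deriv_nonpos (convex_Ici 1)
      (fun r hr => (hd r hr).continuousAt.continuousWithinAt)
      (fun r hr => (hd r (interior_subset hr)).differentiableWithinAt) fun r hr => ?_
    have hr0 : (0 : ℝ) < r := lt_of_lt_of_le one_pos (mem_Ici.1 (interior_subset hr))
    rw [(hLd r hr0).deriv]
    exact hneg r hr0
  refine ⟨L 1 / t ^ 2, fun r hr => ?_⟩
  have hr0 : 0 < r := by linarith
  rw [le_div_iff₀ (by positivity)]
  refine le_trans ?_ (hanti (mem_Ici.2 le_rfl) (mem_Ici.2 hr) hr)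
  have hexp : 1 ≤ Real.exp (K / r) := Real.one_le_exp (by positivity)
  simp only [hL]
  have hA : 0 ≤ r ^ n * (p r ^ 2 + t ^ 2 * φ r ^ 2) := by positivity
  have hB : 0 ≤ r ^ n * p r ^ 2 := by positivity
  nlinarith

lemma hasDerivAt_integral_of_forall_bound {X : Type*} [MeasurableSpace X] [TopologicalSpace X]
    [OpensMeasurableSpace X] [SecondCountableTopology X] {σ : Measure X} [IsFiniteMeasure σ]
    {F F' : ℝ → X → ℝ} (hF : ∀ r, Continuous (F r)) (hF' : ∀ r, Continuous (F' r))
    (h : ∀ y r, HasDerivAt (fun r => F r y) (F' r y) r) (B : ℝ)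
    (hB : ∀ᵐ y ∂σ, ∀ r, |F r y| ≤ B ∧ |F' r y| ≤ B) (r : ℝ) :
    HasDerivAt (fun r => ∫ y, F r y ∂σ) (∫ y, F' r y ∂σ) r := by
  refine (hasDerivAt_integral_of_dominated_loc_of_deriv_le (bound := fun _ => B)
    Filter.univ_mem (Filter.Eventually.of_forall fun r => (hF r).aestronglyMeasurable) ?_
    (hF' r).aestronglyMeasurable ?_ (integrable_const B)
    (Filter.Eventually.of_forall fun y r _ => h y r)).2
  · exact Integrable.of_bound (hF r).aestronglyMeasurable B (hB.mono fun y hy => (hy r).1)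
  · exact hB.mono fun y hy r _ => (hy r).2

section RotationInvariant

variable {n : ℕ} {σ : Measure (EuclideanSpace ℝ (Fin (n + 1)))}

lemma integral_cos_inner_eq_of_norm_eq
    (hinv : ∀ e : EuclideanSpace ℝ (Fin (n + 1)) ≃ₗᵢ[ℝ] EuclideanSpace ℝ (Fin (n + 1)),
      σ.map e = σ) {ξ η : EuclideanSpace ℝ (Fin (n + 1))} (h : ‖ξ‖ = ‖η‖) :
    ∫ y, Real.cos ⟪y, ξ⟫ ∂σ = ∫ y, Real.cos ⟪y, η⟫ ∂σ := by
  set e := (ℝ ∙ (ξ - η))ᗮ.reflection with he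
  have heξ : e ξ = η := Submodule.reflection_sub h
  conv_rhs => rw [← hinv e]
  rw [integral_map e.continuous.measurable.aemeasurable (by fun_prop)]
  simp [← heξ, LinearIsometryEquiv.inner_map_map]

variable [IsFiniteMeasure σ]

/-- Infinitesimal form of the invariance under rotations in the plane of the coordinates
`0` and `j`. -/
lemma integral_coord_sq_mul_cos
    (hinv : ∀ e : EuclideanSpace ℝ (Fin (n + 1)) ≃ₗᵢ[ℝ] EuclideanSpace ℝ (Fin (n + 1)),
      σ.map e = σ) {t : ℝ} (hσ : ∀ᵐ y ∂σ, ‖y‖ = t) {j : Fin (n + 1)} (hj : j ≠ 0) (r : ℝ) :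
    r ^ 2 * ∫ y, y j ^ 2 * Real.cos (r * y 0) ∂σ = r * ∫ y, y 0 * Real.sin (r * y 0) ∂σ := by
  have hcoord : ∀ᵐ y ∂σ, ∀ i, |y i| ≤ t := hσ.mono fun y hy i => by
    rw [← hy, ← Real.norm_eq_abs]; exact PiLp.norm_apply_le y i
  let u : ℝ → EuclideanSpace ℝ (Fin (n + 1)) → ℝ :=
    fun θ y => Real.cos θ * y 0 + Real.sin θ * y j
  let v : ℝ → EuclideanSpace ℝ (Fin (n + 1)) → ℝ :=
    fun θ y => -Real.sin θ * y 0 + Real.cos θ * y j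
  have hu : ∀ y θ, HasDerivAt (fun θ => u θ y) (v θ y) θ := fun y θ =>
    ((Real.hasDerivAt_cos θ).mul_const _).add ((Real.hasDerivAt_sin θ).mul_const _)
  have hv : ∀ y θ, HasDerivAt (fun θ => v θ y) (-u θ y) θ := fun y θ => by
    refine (((Real.hasDerivAt_sin θ).neg.mul_const _).add
      ((Real.hasDerivAt_cos θ).mul_const _)).congr_deriv ?_
    simp only [u]; ring
  have huv : ∀ᵐ y ∂σ, ∀ θ, |u θ y| ≤ 2 * t ∧ |v θ y| ≤ 2 * t := by
    filter_upwards [hcoord] with y hy θ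
    have hc := Real.abs_cos_le_one θ
    have hs := Real.abs_sin_le_one θ
    have h0 := hy 0
    have hj := hy j
    have m : ∀ a b : ℝ, |a| ≤ 1 → |b| ≤ t → |a * b| ≤ t := fun a b ha hb => by
      rw [abs_mul]; nlinarith [abs_nonneg a, abs_nonneg b]
    constructor
    · refine (abs_add_le _ _).trans ?_
      linarith [m _ _ hc h0, m _ _ hs hj]
    · refine (abs_add_le _ _).trans ?_
      linarith [m _ _ (by rwa [abs_neg] : |-Real.sin θ| ≤ 1) h0, m _ _ hc hj]
  have hconst : ∀ θ, ∫ y, Real.cos (r * u θ y) ∂σ = ∫ y, Real.cos (r * u 0 y) ∂σ := by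
    let w : ℝ → EuclideanSpace ℝ (Fin (n + 1)) := fun θ =>
      r • (EuclideanSpace.single 0 (Real.cos θ) + EuclideanSpace.single j (Real.sin θ))
    have hw : ∀ θ y, ⟪y, w θ⟫ = r * u θ y := fun θ y => by
      simp only [w, u, inner_smul_right, inner_add_right, EuclideanSpace.inner_single_right]
      simp
    have hn : ∀ θ, ‖w θ‖ ^ 2 = r ^ 2 := fun θ => by
      rw [norm_smul, mul_pow, Real.norm_eq_abs, sq_abs, norm_add_sq_real,
        EuclideanSpace.inner_single_left]
      simp [hj.symm, Real.cos_sq_add_sin_sq]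
    intro θ
    simp_rw [← hw]
    refine integral_cos_inner_eq_of_norm_eq hinv ?_
    rw [← sq_eq_sq₀ (norm_nonneg _) (norm_nonneg _), hn, hn]
  have hd1 : ∀ θ, HasDerivAt (fun θ => ∫ y, Real.cos (r * u θ y) ∂σ)
      (∫ y, -Real.sin (r * u θ y) * (r * v θ y) ∂σ) θ := by
    refine hasDerivAt_integral_of_forall_bound (by fun_prop) (by fun_prop)
      (fun y θ => ((hu y θ).const_mul r).cos) (1 + |r| * (2 * t)) ?_
    filter_upwards [huv] with y hy θ
    have ht : 0 ≤ 2 * t := (abs_nonneg _).trans (hy θ).1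
    constructor
    · refine (Real.abs_cos_le_one _).trans ?_
      have : 0 ≤ |r| * (2 * t) := by positivity
      linarith
    · rw [abs_mul, abs_neg, abs_mul]
      calc _ ≤ 1 * (|r| * (2 * t)) := by
            gcongr
            · exact Real.abs_sin_le_one _
            · exact (hy θ).2
        _ ≤ _ := by linarith
  have hz1 : ∀ θ, ∫ y, -Real.sin (r * u θ y) * (r * v θ y) ∂σ = 0 := fun θ => by
    have := hd1 θ
    rw [funext hconst] at this
    exact this.unique (hasDerivAt_const _ _)
  have hd2 : ∀ θ, HasDerivAt (fun θ => ∫ y, -Real.sin (r * u θ y) * (r * v θ y) ∂σ)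
      (∫ y, (-(Real.cos (r * u θ y) * (r * v θ y)) * (r * v θ y) +
        -Real.sin (r * u θ y) * (r * -u θ y)) ∂σ) θ := by
    refine hasDerivAt_integral_of_forall_bound (by fun_prop) (by fun_prop)
      (fun y θ => (((hu y θ).const_mul r).sin.neg.mul ((hv y θ).const_mul r)))
      (|r| * (2 * t) + (|r| * (2 * t)) * (|r| * (2 * t))) ?_
    filter_upwards [huv] with y hy θ
    have ht : 0 ≤ 2 * t := (abs_nonneg _).trans (hy θ).1
    have hs := Real.abs_sin_le_one (r * u θ y)
    have hc := Real.abs_cos_le_one (r * u θ y)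
    have hrv : |r * v θ y| ≤ |r| * (2 * t) := by
      rw [abs_mul]; gcongr; exact (hy θ).2
    have hru : |r * -u θ y| ≤ |r| * (2 * t) := by
      rw [abs_mul, abs_neg]; gcongr; exact (hy θ).1
    constructor
    · rw [abs_mul, abs_neg]
      calc _ ≤ 1 * (|r| * (2 * t)) := by gcongr
        _ ≤ _ := by rw [one_mul]; exact le_add_of_nonneg_right (by positivity)
    · refine (abs_add_le _ _).trans ?_
      rw [abs_mul, abs_neg, abs_mul (Real.cos _), abs_mul (-_), abs_neg]
      calc _ ≤ 1 * (|r| * (2 * t)) * (|r| * (2 * t)) + 1 * (|r| * (2 * t)) := by gcongr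
        _ = _ := by ring
  have hz2 : ∫ y, (-(Real.cos (r * u 0 y) * (r * v 0 y)) * (r * v 0 y) +
        -Real.sin (r * u 0 y) * (r * -u 0 y)) ∂σ = 0 := by
    have := hd2 0
    rw [funext hz1] at this
    exact this.unique (hasDerivAt_const _ _)
  have hint : ∀ f : EuclideanSpace ℝ (Fin (n + 1)) → ℝ, Continuous f →
      ∀ B, (∀ᵐ y ∂σ, |f y| ≤ B) → Integrable f σ := fun f hf B hB =>
    Integrable.of_bound hf.aestronglyMeasurable B hB
  have hI1 : Integrable (fun y => y j ^ 2 * Real.cos (r * y 0)) σ := by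
    refine hint _ (by fun_prop) (t ^ 2) ?_
    filter_upwards [hcoord] with y hy
    rw [abs_mul, abs_pow]
    calc _ ≤ t ^ 2 * 1 := by gcongr; exacts [hy j, Real.abs_cos_le_one _]
      _ = _ := mul_one _
  have hI2 : Integrable (fun y => y 0 * Real.sin (r * y 0)) σ := by
    refine hint _ (by fun_prop) t ?_
    filter_upwards [hcoord] with y hy
    have := hy 0
    have ht : 0 ≤ t := (abs_nonneg _).trans this
    rw [abs_mul]
    calc _ ≤ t * 1 := by gcongr; exacts [Real.abs_sin_le_one _]
      _ = _ := mul_one _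
  rw [← integral_const_mul, ← integral_const_mul, ← sub_eq_zero, ← neg_eq_zero, neg_sub,
    ← integral_sub (hI2.const_mul r) (hI1.const_mul _), ← hz2]
  refine integral_congr_ae (Filter.Eventually.of_forall fun y => ?_)
  simp only [u, v, Real.cos_zero, Real.sin_zero]
  ring_nf

lemma exists_integral_cos_decay
    (hinv : ∀ e : EuclideanSpace ℝ (Fin (n + 1)) ≃ₗᵢ[ℝ] EuclideanSpace ℝ (Fin (n + 1)),
      σ.map e = σ) {t : ℝ} (ht : 0 < t) (hσ : ∀ᵐ y ∂σ, ‖y‖ = t) :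
    ∃ K, ∀ r, 1 ≤ r → (∫ y, Real.cos (r * y 0) ∂σ) ^ 2 * r ^ n ≤ K := by
  have hcoord : ∀ᵐ y ∂σ, ∀ i, |y i| ≤ t := hσ.mono fun y hy i => by
    rw [← hy, ← Real.norm_eq_abs]; exact PiLp.norm_apply_le y i
  have hI : ∀ (i : Fin (n + 1)) (r : ℝ),
      Integrable (fun y => y i ^ 2 * Real.cos (r * y 0)) σ := fun i r => by
    refine Integrable.of_bound (by fun_prop) (t ^ 2) ?_
    filter_upwards [hcoord] with y hy
    rw [Real.norm_eq_abs, abs_mul, abs_pow]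
    calc _ ≤ t ^ 2 * 1 := by gcongr; exacts [hy i, Real.abs_cos_le_one _]
      _ = _ := mul_one _
  have hd1 : ∀ r, HasDerivAt (fun r => ∫ y, Real.cos (r * y 0) ∂σ)
      (∫ y, -Real.sin (r * y 0) * y 0 ∂σ) r := by
    refine hasDerivAt_integral_of_forall_bound (by fun_prop) (by fun_prop)
      (fun y r => (hasDerivAt_mul_const (y 0)).cos) (1 + t) ?_
    filter_upwards [hcoord] with y hy r
    refine ⟨(Real.abs_cos_le_one _).trans (by linarith), ?_⟩
    rw [abs_mul, abs_neg]
    calc _ ≤ 1 * t := by gcongr; exacts [Real.abs_sin_le_one _, hy 0]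
      _ ≤ _ := by linarith
  have hd2 : ∀ r, HasDerivAt (fun r => ∫ y, -Real.sin (r * y 0) * y 0 ∂σ)
      (∫ y, -(Real.cos (r * y 0) * y 0) * y 0 ∂σ) r := by
    refine hasDerivAt_integral_of_forall_bound (by fun_prop) (by fun_prop)
      (fun y r => (hasDerivAt_mul_const (y 0)).sin.neg.mul_const (y 0)) (t + t * t) ?_
    filter_upwards [hcoord] with y hy r
    rw [abs_mul, abs_mul, abs_neg, abs_neg, abs_mul]
    have hs := Real.abs_sin_le_one (r * y 0)
    have hc := Real.abs_cos_le_one (r * y 0)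
    constructor
    · calc _ ≤ 1 * t := by gcongr; exact hy 0
        _ ≤ _ := by nlinarith
    · calc _ ≤ 1 * t * t := by gcongr; exacts [hy 0, hy 0]
        _ ≤ _ := by nlinarith
  refine radial_helmholtz_decay ht hd1 fun r hr => (hd2 r).congr_deriv ?_
  have hsum : ∑ j : Fin n, r * ∫ y, y j.succ ^ 2 * Real.cos (r * y 0) ∂σ =
      n * ∫ y, y 0 * Real.sin (r * y 0) ∂σ := by
    have : ∀ j : Fin n, r * ∫ y, y j.succ ^ 2 * Real.cos (r * y 0) ∂σ =
        ∫ y, y 0 * Real.sin (r * y 0) ∂σ := fun j => by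
      have := integral_coord_sq_mul_cos hinv hσ (Fin.succ_ne_zero j) r
      refine mul_left_cancel₀ hr.ne' ?_
      rw [← this]; ring
    simp [this]
  have htot : ∑ i : Fin (n + 1), ∫ y, y i ^ 2 * Real.cos (r * y 0) ∂σ =
      t ^ 2 * ∫ y, Real.cos (r * y 0) ∂σ := by
    rw [← integral_finsetSum _ fun i _ => hI i r, ← integral_const_mul]
    refine integral_congr_ae (hσ.mono fun y hy => ?_)
    simp only
    rw [← Finset.sum_mul, ← EuclideanSpace.real_norm_sq_eq, hy]
  rw [Fin.sum_univ_succ] at htot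
  rw [← Finset.mul_sum] at hsum
  have e1 : ∫ y, -(Real.cos (r * y 0) * y 0) * y 0 ∂σ =
      -∫ y, y 0 ^ 2 * Real.cos (r * y 0) ∂σ := by
    rw [← integral_neg]; congr 1; ext y; ring
  have e2 : ∫ y, -Real.sin (r * y 0) * y 0 ∂σ = -∫ y, y 0 * Real.sin (r * y 0) ∂σ := by
    rw [← integral_neg]; congr 1; ext y; ring
  rw [e1, e2]
  have : (n : ℝ) / r * -∫ y, y 0 * Real.sin (r * y 0) ∂σ =
      -(n * ∫ y, y 0 * Real.sin (r * y 0) ∂σ) / r := by ring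
  rw [this, ← hsum, neg_div, mul_div_cancel_left₀ _ hr.ne']
  linarith

lemma fourierMeasure_eq_integral_cos
    (hinv : ∀ e : EuclideanSpace ℝ (Fin (n + 1)) ≃ₗᵢ[ℝ] EuclideanSpace ℝ (Fin (n + 1)),
      σ.map e = σ) (ξ : EuclideanSpace ℝ (Fin (n + 1))) :
    fourierMeasure σ ξ = ((∫ y, Real.cos (2 * Real.pi * ‖ξ‖ * y 0) ∂σ : ℝ) : ℂ) := by
  have hexp : ∀ f : EuclideanSpace ℝ (Fin (n + 1)) → ℝ, Continuous f →
      Integrable (fun x => Complex.exp (f x * Complex.I)) σ := fun f hf =>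
    Integrable.of_bound (by fun_prop) 1
      (Filter.Eventually.of_forall fun x => (Complex.norm_exp_ofReal_mul_I _).le)
  have hneg : fourierMeasure σ ξ = ∫ x, Complex.exp ((2 * Real.pi * ⟪x, ξ⟫ : ℝ) * Complex.I) ∂σ := by
    unfold fourierMeasure
    conv_lhs => rw [← hinv (LinearIsometryEquiv.neg ℝ)]
    rw [integral_map (LinearIsometryEquiv.continuous _).measurable.aemeasurable (by fun_prop)]
    simp
  have havg : fourierMeasure σ ξ = ∫ x, ((Real.cos (⟪x, (2 * Real.pi) • ξ⟫) : ℝ) : ℂ) ∂σ := by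
    have h2 : fourierMeasure σ ξ + fourierMeasure σ ξ =
        2 * ∫ x, ((Real.cos (⟪x, (2 * Real.pi) • ξ⟫) : ℝ) : ℂ) ∂σ := by
      conv_lhs => enter [2]; rw [hneg]
      unfold fourierMeasure
      rw [← integral_add, ← integral_const_mul]
      · congr 1
        ext x
        rw [Complex.ofReal_cos, Complex.two_cos, inner_smul_right]
        push_cast
        rw [add_comm]
      · have := hexp (fun x => -(2 * Real.pi * ⟪x, ξ⟫)) (by fun_prop)
        simpa using this
      · exact hexp _ (by fun_prop)
    linear_combination h2 / 2
  rw [havg, integral_complex_ofReal]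
  congr 1
  have := integral_cos_inner_eq_of_norm_eq hinv (ξ := (2 * Real.pi) • ξ)
    (η := EuclideanSpace.single 0 (2 * Real.pi * ‖ξ‖)) (by
      rw [norm_smul]; simp)
  rw [this]
  simp [EuclideanSpace.inner_single_right]

/-- Decay of the Fourier transform of a rotation invariant measure on a sphere. -/
lemma exists_norm_fourierMeasure_le
    (hinv : ∀ e : EuclideanSpace ℝ (Fin (n + 1)) ≃ₗᵢ[ℝ] EuclideanSpace ℝ (Fin (n + 1)),
      σ.map e = σ) {t : ℝ} (ht : 0 < t) (hσ : ∀ᵐ y ∂σ, ‖y‖ = t) :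
    ∃ D, 0 < D ∧ ∀ ξ, ξ ≠ 0 → ‖fourierMeasure σ ξ‖ ≤ D * ‖ξ‖ ^ (-((n : ℝ) / 2)) := by
  obtain ⟨K, hK⟩ := exists_integral_cos_decay hinv ht hσ
  set A := σ.real univ with hA
  have hA0 : 0 ≤ A := measureReal_nonneg
  refine ⟨A + √K + 1, by positivity, fun ξ hξ => ?_⟩
  have hx : 0 < ‖ξ‖ := norm_pos_iff.2 hξ
  rw [fourierMeasure_eq_integral_cos hinv, Complex.norm_real, Real.norm_eq_abs,
    Real.rpow_neg hx.le, ← div_eq_mul_inv, le_div_iff₀ (by positivity)]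
  set I := ∫ y, Real.cos (2 * Real.pi * ‖ξ‖ * y 0) ∂σ with hI
  have hpi := Real.pi_gt_three
  by_cases h1 : 1 ≤ ‖ξ‖
  · have hr : ‖ξ‖ ≤ 2 * Real.pi * ‖ξ‖ := by nlinarith
    have h2 := hK (2 * Real.pi * ‖ξ‖) (h1.trans hr)
    have h3 : (|I| * ‖ξ‖ ^ ((n : ℝ) / 2)) ^ 2 ≤ K := by
      rw [mul_pow, sq_abs, ← Real.rpow_natCast (‖ξ‖ ^ ((n : ℝ) / 2)), ← Real.rpow_mul hx.le]
      have : (n : ℝ) / 2 * (2 : ℕ) = n := by push_cast; ring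
      rw [this, Real.rpow_natCast]
      refine le_trans ?_ h2
      gcongr
    have := Real.le_sqrt_of_sq_le h3
    linarith
  · have hIA : |I| ≤ A := by
      have := norm_integral_le_of_norm_le_const (μ := σ) (C := 1)
        (f := fun y => Real.cos (2 * Real.pi * ‖ξ‖ * y 0))
        (Filter.Eventually.of_forall fun y => Real.abs_cos_le_one _)
      simpa using this
    have h3 : ‖ξ‖ ^ ((n : ℝ) / 2) ≤ 1 :=
      Real.rpow_le_one hx.le (not_le.1 h1).le (by positivity)
    have : |I| * ‖ξ‖ ^ ((n : ℝ) / 2) ≤ A * 1 := by gcongr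
    linarith [Real.sqrt_nonneg K]

end RotationInvariant

section Energy

variable {d : ℕ}

lemma continuous_fourierMeasure (ν : Measure (EuclideanSpace ℝ (Fin d))) [IsFiniteMeasure ν] :
    Continuous (fourierMeasure ν) := by
  unfold fourierMeasure
  refine continuous_of_dominated (bound := fun _ => 1) (fun ξ => by fun_prop) (fun ξ => ?_)
    (integrable_const _) (Filter.Eventually.of_forall fun x => by fun_prop)
  refine Filter.Eventually.of_forall fun x => le_of_eq ?_
  have := Complex.norm_exp_ofReal_mul_I (-(2 * Real.pi * ⟪x, ξ⟫))
  simpa using this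

lemma norm_fourierMeasure_le (ν : Measure (EuclideanSpace ℝ (Fin d))) [IsFiniteMeasure ν]
    (ξ : EuclideanSpace ℝ (Fin d)) : ‖fourierMeasure ν ξ‖ ≤ ν.real univ := by
  have := norm_integral_le_of_norm_le_const (μ := ν) (C := 1)
    (f := fun x => Complex.exp (-(2 * Real.pi * ⟪x, ξ⟫) * Complex.I))
    (Filter.Eventually.of_forall fun x => by
      have := Complex.norm_exp_ofReal_mul_I (-(2 * Real.pi * ⟪x, ξ⟫))
      simpa using this.le)
  simpa [fourierMeasure] using this

lemma conj_fourierMeasure (ν : Measure (EuclideanSpace ℝ (Fin d)))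
    (ξ : EuclideanSpace ℝ (Fin d)) :
    (starRingEnd ℂ) (fourierMeasure ν ξ) =
      ∫ x, Complex.exp ((2 * Real.pi * ⟪x, ξ⟫) * Complex.I) ∂ν := by
  rw [fourierMeasure, ← integral_conj]
  congr 1
  ext x
  rw [← Complex.exp_conj]
  simp [Complex.conj_ofNat]

lemma sq_norm_fourierMeasure (ν : Measure (EuclideanSpace ℝ (Fin d))) [IsFiniteMeasure ν]
    (ξ : EuclideanSpace ℝ (Fin d)) :
    ((‖fourierMeasure ν ξ‖ ^ 2 : ℝ) : ℂ) =
      ∫ p : EuclideanSpace ℝ (Fin d) × EuclideanSpace ℝ (Fin d),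
        Complex.exp (-(2 * Real.pi * ⟪p.1 - p.2, ξ⟫) * Complex.I) ∂(ν.prod ν) := by
  rw [Complex.ofReal_pow, ← Complex.mul_conj', conj_fourierMeasure, fourierMeasure,
    ← integral_prod_mul]
  congr 1
  ext p
  rw [← Complex.exp_add, inner_sub_left]
  congr 1
  push_cast
  ring

lemma integral_gaussian_mul_character {u : ℝ} (hu : 0 < u) (z : EuclideanSpace ℝ (Fin d)) :
    ∫ ξ : EuclideanSpace ℝ (Fin d), Complex.exp (-(2 * Real.pi * ⟪z, ξ⟫) * Complex.I) *
        (Real.exp (-(Real.pi * u * ‖ξ‖ ^ 2)) : ℝ) =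
      ((u ^ (-((d : ℝ) / 2)) * Real.exp (-(Real.pi * ‖z‖ ^ 2 / u)) : ℝ) : ℂ) := by
  have hb : 0 < ((Real.pi * u : ℝ) : ℂ).re := by simpa using mul_pos Real.pi_pos hu
  have h := fourier_gaussian_innerProductSpace (V := EuclideanSpace ℝ (Fin d)) hb z
  rw [Real.fourier_eq'] at h
  have hc : ((Real.pi : ℂ) / ((Real.pi * u : ℝ) : ℂ)) ^
      ((Module.finrank ℝ (EuclideanSpace ℝ (Fin d)) : ℂ) / 2) =
      ((u ^ (-((d : ℝ) / 2)) : ℝ) : ℂ) := by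
    rw [Complex.ofReal_cpow hu.le, finrank_euclideanSpace_fin]
    have : (Real.pi : ℂ) / ((Real.pi * u : ℝ) : ℂ) = ((u⁻¹ : ℝ) : ℂ) := by
      rw [← Complex.ofReal_div]; congr 1
      field_simp
    rw [this]
    have h2 : ((d : ℂ) / 2) = (((d : ℝ) / 2 : ℝ) : ℂ) := by push_cast; ring
    rw [h2, ← Complex.ofReal_cpow (by positivity), ← Complex.ofReal_cpow hu.le,
      Real.inv_rpow hu.le, Real.rpow_neg hu.le]
  rw [hc] at h
  rw [Complex.ofReal_mul]
  convert h using 1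
  · congr 1
    ext ξ
    rw [smul_eq_mul, real_inner_comm]
    push_cast
    ring_nf
  · congr 1
    push_cast
    congr 1
    have : (Real.pi : ℂ) ≠ 0 := by exact_mod_cast Real.pi_ne_zero
    have : (u : ℂ) ≠ 0 := by exact_mod_cast hu.ne'
    field_simp

lemma integrable_exp_neg_mul_sq_norm {u : ℝ} (hu : 0 < u) :
    Integrable (fun ξ : EuclideanSpace ℝ (Fin d) => Real.exp (-(Real.pi * u * ‖ξ‖ ^ 2))) := by
  have hb : 0 < ((Real.pi * u : ℝ) : ℂ).re := by simpa using mul_pos Real.pi_pos hu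
  have h := GaussianFourier.integrable_cexp_neg_mul_sq_norm_add (V := EuclideanSpace ℝ (Fin d))
    hb 0 0
  refine h.norm.congr (Filter.Eventually.of_forall fun ξ => ?_)
  simp [Complex.norm_exp, ← Complex.ofReal_pow]

lemma lintegral_sq_fourierMeasure_mul_gaussian (ν : Measure (EuclideanSpace ℝ (Fin d)))
    [IsFiniteMeasure ν] {u : ℝ} (hu : 0 < u) :
    ∫⁻ ξ, ‖fourierMeasure ν ξ‖₊ ^ 2 * ENNReal.ofReal (Real.exp (-(Real.pi * u * ‖ξ‖ ^ 2))) =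
      ∫⁻ x, ∫⁻ y, ENNReal.ofReal
        (u ^ (-((d : ℝ) / 2)) * Real.exp (-(Real.pi * ‖x - y‖ ^ 2 / u))) ∂ν ∂ν := by
  have hg := integrable_exp_neg_mul_sq_norm (d := d) hu
  have hcont := continuous_fourierMeasure ν
  have hreal : ∫ ξ, ‖fourierMeasure ν ξ‖ ^ 2 * Real.exp (-(Real.pi * u * ‖ξ‖ ^ 2)) =
      ∫ p : EuclideanSpace ℝ (Fin d) × EuclideanSpace ℝ (Fin d),
        u ^ (-((d : ℝ) / 2)) * Real.exp (-(Real.pi * ‖p.1 - p.2‖ ^ 2 / u)) ∂(ν.prod ν) := by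
    apply Complex.ofReal_injective
    rw [← integral_complex_ofReal, ← integral_complex_ofReal]
    simp_rw [← integral_gaussian_mul_character hu]
    rw [integral_integral_swap]
    · congr 1
      ext ξ
      rw [integral_mul_const, ← sq_norm_fourierMeasure]
      push_cast
      rfl
    · have hdom : Integrable (fun q : (EuclideanSpace ℝ (Fin d) × EuclideanSpace ℝ (Fin d)) ×
          EuclideanSpace ℝ (Fin d) => (1 : ℝ) * Real.exp (-(Real.pi * u * ‖q.2‖ ^ 2)))
          ((ν.prod ν).prod volume) := Integrable.mul_prod (integrable_const (1 : ℝ)) hg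
      refine hdom.mono' (by fun_prop) (Filter.Eventually.of_forall fun q => le_of_eq ?_)
      have := Complex.norm_exp_ofReal_mul_I (-(2 * Real.pi * ⟪q.1.1 - q.1.2, q.2⟫))
      simp only [Function.uncurry, norm_mul, Complex.norm_real, Real.norm_eq_abs, Real.abs_exp]
      congr 1
      simpa using this
  have hpos : 0 < u ^ (-((d : ℝ) / 2)) := Real.rpow_pos_of_pos hu _
  have h1 : ∀ ξ, (‖fourierMeasure ν ξ‖₊ : ℝ≥0∞) ^ 2 *
      ENNReal.ofReal (Real.exp (-(Real.pi * u * ‖ξ‖ ^ 2))) =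
      ENNReal.ofReal (‖fourierMeasure ν ξ‖ ^ 2 * Real.exp (-(Real.pi * u * ‖ξ‖ ^ 2))) := fun ξ => by
    rw [ENNReal.ofReal_mul (by positivity), ENNReal.ofReal_pow (norm_nonneg _),
      ofReal_norm, enorm_eq_nnnorm]
  simp_rw [h1]
  rw [← ofReal_integral_eq_lintegral_ofReal, hreal, ofReal_integral_eq_lintegral_ofReal,
    lintegral_prod]
  · fun_prop
  · refine Integrable.of_bound (by fun_prop) (u ^ (-((d : ℝ) / 2)))
      (Filter.Eventually.of_forall fun p => ?_)
    rw [Real.norm_eq_abs, abs_of_nonneg (by positivity)]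
    refine mul_le_of_le_one_right hpos.le (Real.exp_le_one_iff.2 ?_)
    rw [neg_nonpos]; positivity
  · exact Filter.Eventually.of_forall fun p => by positivity
  · refine (hg.const_mul (ν.real univ ^ 2)).mono' (by fun_prop)
      (Filter.Eventually.of_forall fun ξ => ?_)
    rw [Real.norm_eq_abs, abs_of_nonneg (by positivity)]
    gcongr
    exact norm_fourierMeasure_le ν ξ
  · exact Filter.Eventually.of_forall fun p => by positivity

/-- Schur test for a symmetric kernel. -/
lemma lintegral_lintegral_withDensity_le {X : Type*} [MeasurableSpace X] (μ : Measure X)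
    [SFinite μ] {f : X → ℝ≥0∞} (hf : Measurable f) {K : X → X → ℝ≥0∞}
    (hK : Measurable (Function.uncurry K)) (hsymm : ∀ x y, K x y = K y x) {M : ℝ≥0∞}
    (hM : ∀ x, ∫⁻ y, K x y ∂μ ≤ M) :
    ∫⁻ x, ∫⁻ y, K x y ∂(μ.withDensity f) ∂(μ.withDensity f) ≤ 2 * M * ∫⁻ x, f x ^ 2 ∂μ := by
  have hKx : ∀ x, Measurable (K x) := fun x => hK.of_uncurry_left
  have hmeas : Measurable fun x => ∫⁻ y, f y * K x y ∂μ := by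
    refine Measurable.lintegral_prod_right (f := fun x y => f y * K x y) ?_
    exact (hf.comp measurable_snd).mul hK
  have hA : ∫⁻ x, ∫⁻ y, f x ^ 2 * K x y ∂μ ∂μ ≤ M * ∫⁻ x, f x ^ 2 ∂μ := by
    rw [← lintegral_const_mul _ (hf.pow_const 2)]
    refine lintegral_mono fun x => ?_
    simp only
    rw [lintegral_const_mul _ (hKx x), mul_comm]
    gcongr
    exact hM x
  have hB : ∫⁻ x, ∫⁻ y, f y ^ 2 * K x y ∂μ ∂μ = ∫⁻ x, ∫⁻ y, f x ^ 2 * K x y ∂μ ∂μ := by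
    rw [lintegral_lintegral_swap]
    · simp_rw [hsymm]
    · exact (((hf.comp measurable_snd).pow_const 2).mul hK).aemeasurable
  have hfK : Measurable (fun p : X × X => f p.1 ^ 2 * K p.1 p.2) :=
    ((hf.comp measurable_fst).pow_const 2).mul hK
  calc ∫⁻ x, ∫⁻ y, K x y ∂(μ.withDensity f) ∂(μ.withDensity f)
      = ∫⁻ x, f x * ∫⁻ y, f y * K x y ∂μ ∂μ := by
        simp_rw [lintegral_withDensity_eq_lintegral_mul μ hf (hKx _)]
        rw [lintegral_withDensity_eq_lintegral_mul μ hf]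
        · rfl
        · exact hmeas
    _ ≤ ∫⁻ x, (∫⁻ y, f x ^ 2 * K x y ∂μ + ∫⁻ y, f y ^ 2 * K x y ∂μ) ∂μ := by
        refine lintegral_mono fun x => ?_
        simp only
        rw [← lintegral_add_left ((hKx x).const_mul _), 
          ← lintegral_const_mul (f x) (f := fun y => f y * K x y) (hf.mul (hKx x))]
        refine lintegral_mono fun y => ?_
        simp only
        rw [← mul_assoc, ← add_mul]
        gcongr
        rcases le_total (f x) (f y) with h | h
        · calc f x * f y ≤ f y * f y := by gcongr
            _ ≤ _ := by rw [← sq]; exact le_add_self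
        · calc f x * f y ≤ f x * f x := by gcongr
            _ ≤ _ := by rw [← sq]; exact le_self_add
    _ = 2 * ∫⁻ x, ∫⁻ y, f x ^ 2 * K x y ∂μ ∂μ := by
        rw [lintegral_add_left hfK.lintegral_prod_right, hB, two_mul]
    _ ≤ _ := by rw [mul_assoc]; gcongr

lemma lintegral_exp_neg_sq_dist_le (μ : Measure (EuclideanSpace ℝ (Fin d))) [IsFiniteMeasure μ]
    {C s : ℝ} (hC : 0 < C) (hs : 0 < s)
    (hball : ∀ (x : EuclideanSpace ℝ (Fin d)) (r : ℝ), 0 < r →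
      μ (closedBall x r) ≤ ENNReal.ofReal (C * r ^ s)) {u : ℝ} (hu : 0 < u)
    (x : EuclideanSpace ℝ (Fin d)) :
    ∫⁻ y, ENNReal.ofReal (Real.exp (-(Real.pi * ‖x - y‖ ^ 2 / u))) ∂μ ≤
      ENNReal.ofReal (C * Real.Gamma (s / 2 + 1) * (u / Real.pi) ^ (s / 2)) := by
  have hpi := Real.pi_pos
  let T : Set (EuclideanSpace ℝ (Fin d) × ℝ) := {p | Real.pi * ‖x - p.1‖ ^ 2 / u < p.2}
  have hT : MeasurableSet T := measurableSet_lt (by fun_prop) (by fun_prop)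
  let G : EuclideanSpace ℝ (Fin d) → ℝ → ℝ≥0∞ :=
    fun y v => T.indicator (fun p => ENNReal.ofReal (Real.exp (-p.2))) (y, v)
  have hG : Measurable (Function.uncurry G) := by
    have : Measurable (T.indicator fun p => ENNReal.ofReal (Real.exp (-p.2))) :=
      Measurable.indicator (by fun_prop) hT
    exact this
  have hexp : ∀ y, ENNReal.ofReal (Real.exp (-(Real.pi * ‖x - y‖ ^ 2 / u))) =
      ∫⁻ v in Ioi 0, G y v := by
    intro y
    have ha : 0 ≤ Real.pi * ‖x - y‖ ^ 2 / u := by positivity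
    set a := Real.pi * ‖x - y‖ ^ 2 / u with ha'
    have hGi : ∀ v, G y v = (Ioi a).indicator (fun v => ENNReal.ofReal (Real.exp (-v))) v := by
      intro v
      by_cases hv : a < v
      · rw [indicator_of_mem (show v ∈ Ioi a from hv)]
        exact indicator_of_mem (show (y, v) ∈ T from hv) _
      · rw [indicator_of_notMem (show v ∉ Ioi a from hv)]
        exact indicator_of_notMem (show (y, v) ∉ T from hv) _
    simp_rw [hGi]
    rw [setLIntegral_indicator measurableSet_Ioi, inter_eq_left.2 (Ioi_subset_Ioi ha),
      ← integral_exp_neg_Ioi a, ofReal_integral_eq_lintegral_ofReal]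
    · exact integrableOn_exp_neg_Ioi a
    · exact Filter.Eventually.of_forall fun v => (Real.exp_pos _).le
  simp_rw [hexp]
  rw [lintegral_lintegral_swap hG.aemeasurable]
  have hΓ : ENNReal.ofReal (C * Real.Gamma (s / 2 + 1) * (u / Real.pi) ^ (s / 2)) =
      ∫⁻ v in Ioi (0 : ℝ), ENNReal.ofReal
        (C * (u / Real.pi) ^ (s / 2) * (Real.exp (-v) * v ^ (s / 2 + 1 - 1))) := by
    rw [← ofReal_integral_eq_lintegral_ofReal, integral_const_mul,
      ← Real.Gamma_eq_integral (by positivity)]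
    · congr 1; ring
    · exact (Real.GammaIntegral_convergent (by positivity)).const_mul _
    · refine (ae_restrict_iff' measurableSet_Ioi).2 (Filter.Eventually.of_forall fun v hv => ?_)
      have : (0 : ℝ) < v := hv
      simp only [Pi.zero_apply]
      positivity
  rw [hΓ]
  refine setLIntegral_mono' measurableSet_Ioi fun v hv => ?_
  have hv : (0 : ℝ) < v := hv
  have hset : {y | (y, v) ∈ T} ⊆ closedBall x (√(u / Real.pi * v)) := by
    intro y hy
    have hy : Real.pi * ‖x - y‖ ^ 2 / u < v := hy
    rw [mem_closedBall', dist_eq_norm]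
    refine Real.le_sqrt_of_sq_le ?_
    rw [div_lt_iff₀ hu] at hy
    rw [div_mul_eq_mul_div, le_div_iff₀ hpi]
    linarith
  have hGT : ∀ y, G y v = {y | (y, v) ∈ T}.indicator (fun _ => ENNReal.ofReal (Real.exp (-v))) y :=
    fun y => rfl
  simp_rw [hGT]
  rw [lintegral_indicator_const
    (show MeasurableSet {y | (y, v) ∈ T} from hT.preimage measurable_prodMk_right)]
  have hr : 0 < √(u / Real.pi * v) := Real.sqrt_pos.2 (by positivity)
  calc _ ≤ ENNReal.ofReal (Real.exp (-v)) * ENNReal.ofReal (C * √(u / Real.pi * v) ^ s) := by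
        gcongr
        exact (measure_mono hset).trans (hball x _ hr)
    _ = _ := by
        rw [← ENNReal.ofReal_mul (Real.exp_pos _).le, Real.sqrt_eq_rpow,
          ← Real.rpow_mul (by positivity), Real.mul_rpow (by positivity) hv.le]
        congr 1
        rw [add_sub_cancel_right, one_div_mul_eq_div]
        ring

lemma ofReal_norm_rpow_neg_le {α : ℝ} (hα : 0 < α) (ξ : EuclideanSpace ℝ (Fin d)) :
    ENNReal.ofReal (‖ξ‖ ^ (-α)) ≤ ENNReal.ofReal (Real.pi ^ (α / 2) / Real.Gamma (α / 2)) *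
      ∫⁻ u in Ioi (0 : ℝ), ENNReal.ofReal (u ^ (α / 2 - 1)) *
        ENNReal.ofReal (Real.exp (-(Real.pi * u * ‖ξ‖ ^ 2))) := by
  rcases eq_or_ne ξ 0 with rfl | hξ
  · simp [Real.zero_rpow (neg_ne_zero.2 hα.ne')]
  have hx : 0 < ‖ξ‖ := norm_pos_iff.2 hξ
  have hpi := Real.pi_pos
  have hΓ : 0 < Real.Gamma (α / 2) := Real.Gamma_pos_of_pos (by positivity)
  have h := Real.integral_rpow_mul_exp_neg_mul_Ioi (a := α / 2) (r := Real.pi * ‖ξ‖ ^ 2)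
    (by positivity) (by positivity)
  have hint : IntegrableOn (fun t : ℝ => t ^ (α / 2 - 1) *
      Real.exp (-(Real.pi * ‖ξ‖ ^ 2 * t))) (Ioi 0) := by
    by_contra hcon
    rw [integral_undef hcon] at h
    have : 0 < (1 / (Real.pi * ‖ξ‖ ^ 2)) ^ (α / 2) * Real.Gamma (α / 2) := by positivity
    exact this.ne h
  have h2 : ∫⁻ u in Ioi (0 : ℝ), ENNReal.ofReal (u ^ (α / 2 - 1)) *
        ENNReal.ofReal (Real.exp (-(Real.pi * u * ‖ξ‖ ^ 2))) =
      ENNReal.ofReal ((1 / (Real.pi * ‖ξ‖ ^ 2)) ^ (α / 2) * Real.Gamma (α / 2)) := by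
    rw [← h, ofReal_integral_eq_lintegral_ofReal hint]
    · refine setLIntegral_congr_fun measurableSet_Ioi fun u hu => ?_
      have hu : (0 : ℝ) < u := hu
      rw [← ENNReal.ofReal_mul (by positivity)]
      ring_nf
    · refine (ae_restrict_iff' measurableSet_Ioi).2 (Filter.Eventually.of_forall fun v hv => ?_)
      have : (0 : ℝ) < v := hv
      simp only [Pi.zero_apply]
      positivity
  rw [h2, ← ENNReal.ofReal_mul (by positivity)]
  refine le_of_eq (congrArg _ ?_)
  have hsq : (‖ξ‖ ^ 2) ^ (α / 2) = ‖ξ‖ ^ α := by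
    rw [← Real.rpow_natCast, ← Real.rpow_mul hx.le]; congr 1; push_cast; ring
  rw [Real.div_rpow zero_le_one (by positivity), Real.one_rpow,
    Real.mul_rpow hpi.le (by positivity), hsq, Real.rpow_neg hx.le]
  have : 0 < Real.pi ^ (α / 2) := by positivity
  have : 0 < ‖ξ‖ ^ α := by positivity
  field_simp

lemma lintegral_min_rpow_lt_top {b c B : ℝ} (hb : -1 < b) (hc : c < -1) :
    ∫⁻ u in Ioi (0 : ℝ), min (ENNReal.ofReal (B * u ^ b)) (ENNReal.ofReal (u ^ c)) < ∞ := by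
  rw [← Ioc_union_Ioi_eq_Ioi (zero_le_one' ℝ)]
  refine (lintegral_union_le _ _ _).trans_lt (ENNReal.add_lt_top.2 ⟨?_, ?_⟩)
  · refine (lintegral_mono fun u => min_le_left _ _).trans_lt ?_
    have := ((intervalIntegrable_iff_integrableOn_Ioc_of_le zero_le_one).1
      (intervalIntegral.intervalIntegrable_rpow' (a := 0) (b := 1) hb)).const_mul B
    exact (lintegral_mono fun u => Real.ofReal_le_enorm _).trans_lt this.2
  · refine (lintegral_mono fun u => min_le_right _ _).trans_lt ?_
    have := integrableOn_Ioi_rpow_of_lt hc one_pos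
    exact (lintegral_mono fun u => Real.ofReal_le_enorm _).trans_lt this.2

/-- Weighted Fourier energy of `f μ` is controlled by the `L²(μ)` norm of `f` when `μ` is a
Frostman measure. -/
lemma exists_energy_le (μ : Measure (EuclideanSpace ℝ (Fin d))) [IsProbabilityMeasure μ]
    {C s : ℝ} (hC : 0 < C) (hs : 0 < s)
    (hball : ∀ (x : EuclideanSpace ℝ (Fin d)) (r : ℝ), 0 < r →
      μ (closedBall x r) ≤ ENNReal.ofReal (C * r ^ s))
    {α : ℝ} (hα0 : 0 < α) (hα1 : (d : ℝ) - s < α) (hα2 : α < d) :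
    ∃ A : ℝ, 0 < A ∧ ∀ f : EuclideanSpace ℝ (Fin d) → ℝ≥0∞, Measurable f →
      IsFiniteMeasure (μ.withDensity f) →
      ∫⁻ ξ, ‖fourierMeasure (μ.withDensity f) ξ‖₊ ^ 2 * ENNReal.ofReal (‖ξ‖ ^ (-α)) ≤
        ENNReal.ofReal A * ∫⁻ x, f x ^ 2 ∂μ := by
  have hpi := Real.pi_pos
  set B : ℝ := C * Real.Gamma (s / 2 + 1) * (1 / Real.pi) ^ (s / 2) with hB
  set c : ℝ≥0∞ := ENNReal.ofReal (Real.pi ^ (α / 2) / Real.Gamma (α / 2)) with hc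
  set J : ℝ≥0∞ := ∫⁻ u in Ioi (0 : ℝ), min (ENNReal.ofReal (B * u ^ (α / 2 - 1 + (s - d) / 2)))
    (ENNReal.ofReal (u ^ (α / 2 - 1 - d / 2))) with hJ
  have hJfin : J < ∞ := lintegral_min_rpow_lt_top (by linarith) (by linarith)
  have hAfin : c * (2 * J) ≠ ∞ :=
    ENNReal.mul_ne_top ENNReal.ofReal_ne_top (ENNReal.mul_ne_top (by simp) hJfin.ne)
  refine ⟨(c * (2 * J)).toReal + 1, by positivity, fun f hf hfin => ?_⟩
  set ν := μ.withDensity f with hν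
  set N := ∫⁻ x, f x ^ 2 ∂μ with hN
  have hcont := continuous_fourierMeasure ν
  suffices h : ∫⁻ ξ, ‖fourierMeasure ν ξ‖₊ ^ 2 * ENNReal.ofReal (‖ξ‖ ^ (-α)) ≤
      c * (2 * J) * N by
    refine h.trans ?_
    gcongr
    rw [← ENNReal.ofReal_toReal hAfin]
    exact ENNReal.ofReal_le_ofReal (by simp)
  calc ∫⁻ ξ, ‖fourierMeasure ν ξ‖₊ ^ 2 * ENNReal.ofReal (‖ξ‖ ^ (-α))
      ≤ ∫⁻ ξ, ‖fourierMeasure ν ξ‖₊ ^ 2 * (c * ∫⁻ u in Ioi (0 : ℝ),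
          ENNReal.ofReal (u ^ (α / 2 - 1)) *
          ENNReal.ofReal (Real.exp (-(Real.pi * u * ‖ξ‖ ^ 2)))) := by
        gcongr with ξ
        exact ofReal_norm_rpow_neg_le hα0 ξ
    _ = c * ∫⁻ ξ, ∫⁻ u in Ioi (0 : ℝ), ENNReal.ofReal (u ^ (α / 2 - 1)) *
          (‖fourierMeasure ν ξ‖₊ ^ 2 *
            ENNReal.ofReal (Real.exp (-(Real.pi * u * ‖ξ‖ ^ 2)))) := by
        rw [← lintegral_const_mul' _ _ ENNReal.ofReal_ne_top]
        congr 1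
        ext ξ
        rw [mul_left_comm, ← lintegral_const_mul' _ _ (by simp)]
        congr 2
        ext u
        ring
    _ = c * ∫⁻ u in Ioi (0 : ℝ), ENNReal.ofReal (u ^ (α / 2 - 1)) *
          ∫⁻ x, ∫⁻ y, ENNReal.ofReal
            (u ^ (-((d : ℝ) / 2)) * Real.exp (-(Real.pi * ‖x - y‖ ^ 2 / u))) ∂ν ∂ν := by
        rw [lintegral_lintegral_swap]
        · congr 1
          refine setLIntegral_congr_fun measurableSet_Ioi fun u hu => ?_
          rw [lintegral_const_mul' _ _ ENNReal.ofReal_ne_top,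
            lintegral_sq_fourierMeasure_mul_gaussian ν hu]
        · have h1 : Measurable fun u : ℝ => u ^ (α / 2 - 1) := by fun_prop
          fun_prop
    _ ≤ c * ∫⁻ u in Ioi (0 : ℝ), 2 * N *
          min (ENNReal.ofReal (B * u ^ (α / 2 - 1 + (s - d) / 2)))
            (ENNReal.ofReal (u ^ (α / 2 - 1 - d / 2))) := by
        refine mul_le_mul_right (setLIntegral_mono' measurableSet_Ioi fun u hu => ?_) _
        have hu : (0 : ℝ) < u := hu
        have hup : ∀ a : ℝ, 0 < u ^ a := fun a => Real.rpow_pos_of_pos hu a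
        have hM : ∀ x, ∫⁻ y, ENNReal.ofReal
            (u ^ (-((d : ℝ) / 2)) * Real.exp (-(Real.pi * ‖x - y‖ ^ 2 / u))) ∂μ ≤
            ENNReal.ofReal (u ^ (-((d : ℝ) / 2))) *
              min (ENNReal.ofReal (B * u ^ (s / 2))) 1 := by
          intro x
          simp_rw [ENNReal.ofReal_mul (hup _).le]
          rw [lintegral_const_mul' _ _ ENNReal.ofReal_ne_top]
          gcongr
          refine le_min ?_ ?_
          · refine (lintegral_exp_neg_sq_dist_le μ hC hs hball hu x).trans (le_of_eq ?_)
            congr 1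
            rw [div_eq_mul_one_div u, Real.mul_rpow hu.le (by positivity), hB]
            ring
          · calc _ ≤ ∫⁻ _, 1 ∂μ := by
                  refine lintegral_mono fun y => ?_
                  rw [← ENNReal.ofReal_one]
                  refine ENNReal.ofReal_le_ofReal (Real.exp_le_one_iff.2 ?_)
                  rw [neg_nonpos]; positivity
              _ = 1 := by simp
        have hS := lintegral_lintegral_withDensity_le μ hf (K := fun x y => ENNReal.ofReal
            (u ^ (-((d : ℝ) / 2)) * Real.exp (-(Real.pi * ‖x - y‖ ^ 2 / u))))
            (by fun_prop) (fun x y => by rw [norm_sub_rev]) hM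
        refine (mul_le_mul_right hS _).trans (le_of_eq ?_)
        have e1 : u ^ (α / 2 - 1 + (s - d) / 2) =
            u ^ (α / 2 - 1) * (u ^ (-((d : ℝ) / 2)) * u ^ (s / 2)) := by
          rw [← Real.rpow_add hu, ← Real.rpow_add hu]; congr 1; ring
        have e2 : u ^ (α / 2 - 1 - d / 2) = u ^ (α / 2 - 1) * u ^ (-((d : ℝ) / 2)) := by
          rw [← Real.rpow_add hu]; congr 1
        have e3 : min (ENNReal.ofReal (B * u ^ (α / 2 - 1 + (s - d) / 2)))
            (ENNReal.ofReal (u ^ (α / 2 - 1 - d / 2))) =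
            ENNReal.ofReal (u ^ (α / 2 - 1)) * (ENNReal.ofReal (u ^ (-((d : ℝ) / 2))) *
              min (ENNReal.ofReal (B * u ^ (s / 2))) 1) := by
          rw [mul_min, mul_min, mul_one, ← ENNReal.ofReal_mul (hup _).le,
            ← ENNReal.ofReal_mul (hup _).le, ← ENNReal.ofReal_mul (hup _).le, e1, e2]
          congr 2
          ring
        rw [e3]
        ring
    _ = c * (2 * J) * N := by
        rw [lintegral_const_mul _ (by fun_prop)]
        ring

end Energy

open FourierTransform in
/-- Trilinear Fourier bound for `∭ h(x - y - w) dσ(w) dν(y) dκ(x)`. -/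
lemma ofReal_integral_trilinear_le {d : ℕ} (κ ν σ : Measure (EuclideanSpace ℝ (Fin d)))
    [IsFiniteMeasure κ] [IsFiniteMeasure ν] [IsFiniteMeasure σ]
    {h : EuclideanSpace ℝ (Fin d) → ℝ} (hsm : ContDiff ℝ (⊤ : ℕ∞) h) (hsupp : HasCompactSupport h)
    (h0 : ∀ x, 0 ≤ h x) (h1 : ∫ x, h x = 1) :
    ENNReal.ofReal (∫ x, ∫ y, ∫ w, h (x - y - w) ∂σ ∂ν ∂κ) ≤
      ∫⁻ ξ, ‖fourierMeasure κ ξ‖ₑ * ‖fourierMeasure ν ξ‖ₑ * ‖fourierMeasure σ ξ‖ₑ := by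
  have hcsupp : HasCompactSupport fun x => (h x : ℂ) :=
    hsupp.comp_left (g := fun r : ℝ => (r : ℂ)) Complex.ofReal_zero
  have hcsm : ContDiff ℝ (⊤ : ℕ∞) fun x => (h x : ℂ) := Complex.ofRealCLM.contDiff.comp hsm
  let S : SchwartzMap (EuclideanSpace ℝ (Fin d)) ℂ := hcsupp.toSchwartzMap hcsm
  have hS : ∀ x, S x = h x := fun x => rfl
  let H : EuclideanSpace ℝ (Fin d) → ℂ := fun ξ => (𝓕 S) ξ
  have hHint : Integrable H := (𝓕 S).integrable
  have hHcont : Continuous H := (𝓕 S).continuous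
  have hHle : ∀ ξ, ‖H ξ‖ ≤ 1 := by
    intro ξ
    have e : H ξ = 𝓕 (S : EuclideanSpace ℝ (Fin d) → ℂ) ξ := by
      simp only [H, SchwartzMap.fourier_coe]
    rw [e, Real.fourier_eq']
    refine (norm_integral_le_integral_norm _).trans (le_of_eq ?_)
    rw [← h1]
    congr 1
    ext v
    have := Complex.norm_exp_ofReal_mul_I (-2 * Real.pi * ⟪v, ξ⟫)
    rw [norm_smul, this, hS, one_mul, Complex.norm_real, Real.norm_eq_abs, abs_of_nonneg (h0 v)]
  have hinv : ∀ z, (h z : ℂ) = ∫ ξ, Complex.exp ((2 * Real.pi * ⟪z, ξ⟫) * Complex.I) * H ξ := by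
    intro z
    have e : (h z : ℂ) = 𝓕⁻ (H : EuclideanSpace ℝ (Fin d) → ℂ) z := by
      have : S = 𝓕⁻ (𝓕 S) := (FourierTransform.fourierInv_fourier_eq S).symm
      rw [← hS, this, SchwartzMap.fourierInv_coe]
    rw [e, Real.fourierInv_eq']
    congr 1
    ext ξ
    rw [smul_eq_mul, real_inner_comm]
    push_cast
    rfl
  have hhcont : Continuous h := hsm.continuous
  obtain ⟨b, hb⟩ := hsupp.exists_bound_of_continuous hhcont
  set Λ := κ.prod (ν.prod σ) with hΛ
  have hint : Integrable (fun q : EuclideanSpace ℝ (Fin d) × EuclideanSpace ℝ (Fin d) ×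
      EuclideanSpace ℝ (Fin d) => h (q.1 - q.2.1 - q.2.2)) Λ :=
    Integrable.of_bound (by fun_prop) b (Filter.Eventually.of_forall fun q => hb _)
  have hprod : ∫ x, ∫ y, ∫ w, h (x - y - w) ∂σ ∂ν ∂κ =
      ∫ q, h (q.1 - q.2.1 - q.2.2) ∂Λ := by
    rw [hΛ, integral_prod _ hint]
    congr 1
    ext x
    rw [integral_prod]
    exact Integrable.of_bound (by fun_prop) b (Filter.Eventually.of_forall fun q => hb _)
  have hkey : ((∫ q, h (q.1 - q.2.1 - q.2.2) ∂Λ : ℝ) : ℂ) =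
      ∫ ξ, (starRingEnd ℂ) (fourierMeasure κ ξ) * (fourierMeasure ν ξ * fourierMeasure σ ξ) *
        H ξ := by
    rw [← integral_complex_ofReal]
    simp_rw [hinv]
    rw [integral_integral_swap]
    · congr 1
      ext ξ
      rw [integral_mul_const, conj_fourierMeasure, fourierMeasure, fourierMeasure,
        ← integral_prod_mul, ← integral_prod_mul]
      congr 2
      ext q
      rw [← Complex.exp_add, ← Complex.exp_add, inner_sub_left, inner_sub_left]
      congr 1
      push_cast
      ring
    · have hdom : Integrable (fun q : (EuclideanSpace ℝ (Fin d) × EuclideanSpace ℝ (Fin d) ×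
          EuclideanSpace ℝ (Fin d)) × EuclideanSpace ℝ (Fin d) => (1 : ℂ) * H q.2)
          (Λ.prod volume) := Integrable.mul_prod (integrable_const (1 : ℂ)) hHint
      refine hdom.mono (by fun_prop) (Filter.Eventually.of_forall fun q => le_of_eq ?_)
      have := Complex.norm_exp_ofReal_mul_I (2 * Real.pi * ⟪q.1.1 - q.1.2.1 - q.1.2.2, q.2⟫)
      simp only [Function.uncurry, norm_mul, norm_one]
      congr 1
      simpa using this
  calc ENNReal.ofReal (∫ x, ∫ y, ∫ w, h (x - y - w) ∂σ ∂ν ∂κ)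
      ≤ ‖∫ q, h (q.1 - q.2.1 - q.2.2) ∂Λ‖ₑ := by rw [hprod]; exact Real.ofReal_le_enorm _
    _ = ‖((∫ q, h (q.1 - q.2.1 - q.2.2) ∂Λ : ℝ) : ℂ)‖ₑ := by
        rw [← ofReal_norm, ← ofReal_norm, Complex.norm_real]
    _ ≤ ∫⁻ ξ, ‖(starRingEnd ℂ) (fourierMeasure κ ξ) *
          (fourierMeasure ν ξ * fourierMeasure σ ξ) * H ξ‖ₑ := by
        rw [hkey]; exact enorm_integral_le_lintegral_enorm _
    _ ≤ _ := by
        refine lintegral_mono fun ξ => ?_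
        simp only [enorm_mul]
        have e1 : ‖(starRingEnd ℂ) (fourierMeasure κ ξ)‖ₑ = ‖fourierMeasure κ ξ‖ₑ := by
          rw [← ofReal_norm, ← ofReal_norm, RCLike.norm_conj]
        have e2 : ‖H ξ‖ₑ ≤ 1 := by
          rw [← ofReal_norm, ← ENNReal.ofReal_one]
          exact ENNReal.ofReal_le_ofReal (hHle ξ)
        rw [e1]
        calc _ ≤ ‖fourierMeasure κ ξ‖ₑ * (‖fourierMeasure ν ξ‖ₑ * ‖fourierMeasure σ ξ‖ₑ) * 1 := by
              gcongr
          _ = _ := by ring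

/-- `L²(μ)` bound for `f ↦ (σ * h) * (f μ)`, uniform over mollifiers `h`, from Fourier decay
of `σ` and the weighted Fourier energy bound for `μ`. -/
lemma integral_sq_convolution_le {d : ℕ} (hd : d ≠ 0) (μ σ : Measure (EuclideanSpace ℝ (Fin d)))
    [IsFiniteMeasure μ] [IsFiniteMeasure σ] {D β A : ℝ} (hD : 0 < D) (hA : 0 < A)
    (hdecay : ∀ ξ, ξ ≠ 0 → ‖fourierMeasure σ ξ‖ ≤ D * ‖ξ‖ ^ (-β))
    (henergy : ∀ f : EuclideanSpace ℝ (Fin d) → ℝ≥0∞, Measurable f →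
      IsFiniteMeasure (μ.withDensity f) →
      ∫⁻ ξ, ‖fourierMeasure (μ.withDensity f) ξ‖₊ ^ 2 * ENNReal.ofReal (‖ξ‖ ^ (-β)) ≤
        ENNReal.ofReal A * ∫⁻ x, f x ^ 2 ∂μ)
    {h : EuclideanSpace ℝ (Fin d) → ℝ} (hsm : ContDiff ℝ (⊤ : ℕ∞) h) (hsupp : HasCompactSupport h)
    (h0 : ∀ x, 0 ≤ h x) (h1 : ∫ x, h x = 1)
    {f : EuclideanSpace ℝ (Fin d) → ℝ} (hf : Measurable f) (hf0 : ∀ x, 0 ≤ f x)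
    (hfb : ∃ b, ∀ x, f x ≤ b) {G : EuclideanSpace ℝ (Fin d) → ℝ}
    (hG : ∀ x, G x = ∫ y, ∫ w, h (x - y - w) ∂σ ∂(μ.withDensity fun x => ENNReal.ofReal (f x))) :
    Measurable G ∧ (∀ x, 0 ≤ G x) ∧ (∃ b, ∀ x, G x ≤ b) ∧
      ∫ x, G x ^ 2 ∂μ ≤ 4 * (D * A) ^ 2 * ∫ x, f x ^ 2 ∂μ := by
  have hfin : ∀ f : EuclideanSpace ℝ (Fin d) → ℝ, (∃ b, ∀ x, f x ≤ b) →
      IsFiniteMeasure (μ.withDensity fun x => ENNReal.ofReal (f x)) := by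
    rintro f ⟨b, hb⟩
    refine isFiniteMeasure_withDensity ?_
    refine ((lintegral_mono fun x => ENNReal.ofReal_le_ofReal (hb x)).trans_lt ?_).ne
    rw [lintegral_const]
    exact ENNReal.mul_lt_top ENNReal.ofReal_lt_top (measure_lt_top _ _)
  set ν := μ.withDensity fun x => ENNReal.ofReal (f x) with hν
  have hνfin : IsFiniteMeasure ν := hfin f hfb
  have hhcont : Continuous h := hsm.continuous
  obtain ⟨b, hb⟩ := hsupp.exists_bound_of_continuous hhcont
  have hGmeas : Measurable G := by
    rw [funext hG]
    have hg : StronglyMeasurable fun z : EuclideanSpace ℝ (Fin d) => ∫ w, h (z - w) ∂σ :=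
      StronglyMeasurable.integral_prod_right'
        (f := fun p : EuclideanSpace ℝ (Fin d) × EuclideanSpace ℝ (Fin d) => h (p.1 - p.2))
        (by fun_prop : Continuous _).stronglyMeasurable
    exact (StronglyMeasurable.integral_prod_right'
      (f := fun p : EuclideanSpace ℝ (Fin d) × EuclideanSpace ℝ (Fin d) =>
        ∫ w, h (p.1 - p.2 - w) ∂σ)
      (hg.comp_measurable (measurable_fst.sub measurable_snd))).measurable
  have hG0 : ∀ x, 0 ≤ G x := fun x => by
    rw [hG]; exact integral_nonneg fun y => integral_nonneg fun w => h0 _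
  have hGb : ∀ x, G x ≤ b * σ.real univ * ν.real univ := fun x => by
    rw [hG]
    refine (le_abs_self _).trans ?_
    exact norm_integral_le_of_norm_le_const (μ := ν) (C := b * σ.real univ)
      (f := fun y => ∫ w, h (x - y - w) ∂σ) (Filter.Eventually.of_forall fun y =>
        norm_integral_le_of_norm_le_const (μ := σ) (Filter.Eventually.of_forall fun w => hb _))
  refine ⟨hGmeas, hG0, ⟨_, hGb⟩, ?_⟩
  set κ := μ.withDensity fun x => ENNReal.ofReal (G x) with hκ
  have hκfin : IsFiniteMeasure κ := hfin G ⟨_, hGb⟩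
  have hsq : ∀ F : EuclideanSpace ℝ (Fin d) → ℝ, Measurable F → (∀ x, 0 ≤ F x) →
      (∃ b, ∀ x, F x ≤ b) →
      ∫⁻ x, ENNReal.ofReal (F x) ^ 2 ∂μ = ENNReal.ofReal (∫ x, F x ^ 2 ∂μ) := by
    rintro F hF hF0 ⟨b, hb⟩
    rw [ofReal_integral_eq_lintegral_ofReal]
    · simp_rw [ENNReal.ofReal_pow (hF0 _)]
    · refine Integrable.of_bound (by fun_prop) (b ^ 2) (Filter.Eventually.of_forall fun x => ?_)
      rw [Real.norm_eq_abs, abs_of_nonneg (by positivity)]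
      exact pow_le_pow_left₀ (hF0 x) (hb x) 2
    · exact Filter.Eventually.of_forall fun x => by positivity
  set X := ∫ x, G x ^ 2 ∂μ with hX
  set Y := ∫ x, f x ^ 2 ∂μ with hY
  have hX0 : 0 ≤ X := integral_nonneg fun x => by positivity
  have hY0 : 0 ≤ Y := integral_nonneg fun x => by positivity
  have hXκ : X = ∫ x, ∫ y, ∫ w, h (x - y - w) ∂σ ∂ν ∂κ := by
    simp_rw [← hG]
    rw [hκ, integral_withDensity_eq_integral_toReal_smul (by fun_prop)
      (Filter.Eventually.of_forall fun x => ENNReal.ofReal_lt_top)]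
    refine integral_congr_ae (Filter.Eventually.of_forall fun x => ?_)
    simp only [ENNReal.toReal_ofReal (hG0 x), smul_eq_mul]
    ring
  have hEκ := henergy _ (by fun_prop : Measurable fun x => ENNReal.ofReal (G x)) hκfin
  have hEν := henergy _ (by fun_prop : Measurable fun x => ENNReal.ofReal (f x)) hνfin
  rw [hsq G hGmeas hG0 ⟨_, hGb⟩, ← ENNReal.ofReal_mul hA.le] at hEκ
  rw [hsq f hf hf0 hfb, ← ENNReal.ofReal_mul hA.le] at hEν
  set τ : ℝ := 1 / (2 * D * A) with hτ
  have hτ0 : 0 < τ := by positivity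
  have hmul : ∀ a b : ℝ≥0∞, a * b ≤ ENNReal.ofReal τ * a ^ 2 + ENNReal.ofReal τ⁻¹ * b ^ 2 := by
    intro a b
    have hone : ENNReal.ofReal τ * ENNReal.ofReal τ⁻¹ = 1 := by
      rw [← ENNReal.ofReal_mul hτ0.le, mul_inv_cancel₀ hτ0.ne', ENNReal.ofReal_one]
    rcases le_total (ENNReal.ofReal τ * a) b with hab | hab
    · calc a * b = ENNReal.ofReal τ⁻¹ * (ENNReal.ofReal τ * a) * b := by
            rw [← mul_assoc, mul_comm (ENNReal.ofReal τ⁻¹), hone, one_mul]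
        _ ≤ ENNReal.ofReal τ⁻¹ * b * b := by gcongr
        _ = ENNReal.ofReal τ⁻¹ * b ^ 2 := by ring
        _ ≤ _ := le_add_self
    · calc a * b ≤ a * (ENNReal.ofReal τ * a) := by gcongr
        _ = ENNReal.ofReal τ * a ^ 2 := by ring
        _ ≤ _ := le_self_add
  have hbound : ENNReal.ofReal X ≤ ENNReal.ofReal (D * (τ * (A * X) + τ⁻¹ * (A * Y))) := by
    have hκc := continuous_fourierMeasure κ
    have hνc := continuous_fourierMeasure ν
    have hne : ∀ᵐ ξ : EuclideanSpace ℝ (Fin d), ξ ≠ 0 := by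
      have : Nonempty (Fin d) := ⟨⟨0, Nat.pos_of_ne_zero hd⟩⟩
      exact Measure.ae_ne volume 0
    calc ENNReal.ofReal X
        ≤ ∫⁻ ξ, ‖fourierMeasure κ ξ‖ₑ * ‖fourierMeasure ν ξ‖ₑ * ‖fourierMeasure σ ξ‖ₑ := by
          rw [hXκ]
          exact ofReal_integral_trilinear_le κ ν σ hsm hsupp h0 h1
      _ ≤ ∫⁻ ξ, ENNReal.ofReal D *
            (ENNReal.ofReal τ * (‖fourierMeasure κ ξ‖₊ ^ 2 * ENNReal.ofReal (‖ξ‖ ^ (-β))) +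
            ENNReal.ofReal τ⁻¹ * (‖fourierMeasure ν ξ‖₊ ^ 2 * ENNReal.ofReal (‖ξ‖ ^ (-β)))) := by
          refine lintegral_mono_ae (hne.mono fun ξ hξ => ?_)
          have hσ : ‖fourierMeasure σ ξ‖ₑ ≤ ENNReal.ofReal D * ENNReal.ofReal (‖ξ‖ ^ (-β)) := by
            rw [← ofReal_norm, ← ENNReal.ofReal_mul hD.le]
            exact ENNReal.ofReal_le_ofReal (hdecay ξ hξ)
          refine (mul_le_mul' (hmul _ _) hσ).trans (le_of_eq ?_)
          simp only [enorm_eq_nnnorm]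
          ring
      _ = ENNReal.ofReal D * (ENNReal.ofReal τ *
            (∫⁻ ξ, ‖fourierMeasure κ ξ‖₊ ^ 2 * ENNReal.ofReal (‖ξ‖ ^ (-β))) + ENNReal.ofReal τ⁻¹ *
            ∫⁻ ξ, ‖fourierMeasure ν ξ‖₊ ^ 2 * ENNReal.ofReal (‖ξ‖ ^ (-β))) := by
          rw [lintegral_const_mul' _ _ ENNReal.ofReal_ne_top, lintegral_add_left (by fun_prop),
            lintegral_const_mul' _ _ ENNReal.ofReal_ne_top,
            lintegral_const_mul' _ _ ENNReal.ofReal_ne_top]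
      _ ≤ ENNReal.ofReal D * (ENNReal.ofReal τ * ENNReal.ofReal (A * X) +
            ENNReal.ofReal τ⁻¹ * ENNReal.ofReal (A * Y)) := by gcongr
      _ = _ := by
          rw [← ENNReal.ofReal_mul hτ0.le, ← ENNReal.ofReal_mul (by positivity),
            ← ENNReal.ofReal_add (by positivity) (by positivity), ← ENNReal.ofReal_mul hD.le]
  have hreal := (ENNReal.ofReal_le_ofReal_iff (by positivity)).1 hbound
  have e : D * (τ * (A * X) + τ⁻¹ * (A * Y)) = X / 2 + 2 * (D * A) ^ 2 * Y := by
    rw [hτ]; field_simp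
  rw [e] at hreal
  linarith

lemma chainMeasure_eq_withDensity {d : ℕ} (hd : d ≠ 0)
    (μ σ : Measure (EuclideanSpace ℝ (Fin d)))
    [IsProbabilityMeasure μ] [IsFiniteMeasure σ] {D β A : ℝ} (hD : 0 < D) (hA : 0 < A)
    (hdecay : ∀ ξ, ξ ≠ 0 → ‖fourierMeasure σ ξ‖ ≤ D * ‖ξ‖ ^ (-β))
    (henergy : ∀ f : EuclideanSpace ℝ (Fin d) → ℝ≥0∞, Measurable f →
      IsFiniteMeasure (μ.withDensity f) →
      ∫⁻ ξ, ‖fourierMeasure (μ.withDensity f) ξ‖₊ ^ 2 * ENNReal.ofReal (‖ξ‖ ^ (-β)) ≤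
        ENNReal.ofReal A * ∫⁻ x, f x ^ 2 ∂μ)
    {h : EuclideanSpace ℝ (Fin d) → ℝ} (hsm : ContDiff ℝ (⊤ : ℕ∞) h) (hsupp : HasCompactSupport h)
    (h0 : ∀ x, 0 ≤ h x) (h1 : ∫ x, h x = 1) (k : ℕ) :
    ∃ f : EuclideanSpace ℝ (Fin d) → ℝ, Measurable f ∧ (∀ x, 0 ≤ f x) ∧ (∃ b, ∀ x, f x ≤ b) ∧
      ∫ x, f x ^ 2 ∂μ ≤ (4 * (D * A) ^ 2) ^ k ∧
      chainMeasure μ (fun z => ∫ w, h (z - w) ∂σ) k =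
        μ.withDensity fun x => ENNReal.ofReal (f x) := by
  induction k with
  | zero =>
    refine ⟨fun _ => 1, measurable_const, fun _ => zero_le_one, ⟨1, fun _ => le_rfl⟩, ?_, ?_⟩
    · simp
    · simp [chainMeasure]
  | succ k ih =>
    obtain ⟨f, hf, hf0, hfb, hf2, hchain⟩ := ih
    obtain ⟨hG, hG0, hGb, hG2⟩ := integral_sq_convolution_le hd μ σ hD hA hdecay henergy hsm hsupp
      h0 h1 hf hf0 hfb (fun x => rfl)
    refine ⟨_, hG, hG0, hGb, hG2.trans ?_, ?_⟩
    · rw [pow_succ' (4 * (D * A) ^ 2) k]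
      exact mul_le_mul_of_nonneg_left hf2 (by positivity)
    · rw [chainMeasure, hchain]

/-- Let `d ≥ 2`, `t > 0`, and let `μ` be a compactly supported Borel
probability measure on `ℝ^d` with `μ(B(x,r)) ≤ C r^s`, `s > (d+1)/2`. Define recursively
`μ_0^ε = μ` and `dμ_{k+1}^ε(x) = (σ_t^ε * μ_k^ε)(x) dμ(x)`. Then for every
`d - s < α < d` and every `k` there is `C(k)`, independent of `ε ∈ (0,1)`, with
`∫ |\widehat{μ_k^ε}(ξ)|² |ξ|^{-α} dξ ≤ C(k)`. -/
theorem chain_measures_energy_bound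
    (d : ℕ) (hd : 2 ≤ d) (t : ℝ) (ht : 0 < t)
    (μ : Measure (EuclideanSpace ℝ (Fin d))) [IsProbabilityMeasure μ]
    (hμc : ∃ K : Set (EuclideanSpace ℝ (Fin d)), IsCompact K ∧ μ Kᶜ = 0)
    (C s : ℝ) (hC : 0 < C) (hs : ((d : ℝ) + 1) / 2 < s)
    (hball : ∀ (x : EuclideanSpace ℝ (Fin d)) (r : ℝ), 0 < r →
      μ (closedBall x r) ≤ ENNReal.ofReal (C * r ^ s))
    (ρ : EuclideanSpace ℝ (Fin d) → ℝ) (hρ_smooth : ContDiff ℝ (⊤ : ℕ∞) ρ)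
    (hρ_supp : HasCompactSupport ρ) (hρ_nonneg : ∀ x, 0 ≤ ρ x)
    (hρ_int : ∫ x, ρ x = 1) :
    ∀ α : ℝ, (d : ℝ) - s < α → α < d → ∀ k : ℕ,
      ∃ Ck : ℝ, 0 < Ck ∧ ∀ ε ∈ Set.Ioo (0 : ℝ) 1,
        ∫⁻ ξ, ‖fourierMeasure (chainMeasure μ (mollifiedSphere d t ε ρ) k) ξ‖₊ ^ 2 *
            ENNReal.ofReal (‖ξ‖ ^ (-α)) ∂volume
          ≤ ENNReal.ofReal Ck := by
  intro α hα1 hα2 k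
  have hd' : (2 : ℝ) ≤ d := by exact_mod_cast hd
  have hs0 : 0 < s := by linarith
  have hsd : s ≤ d := exponent_le_of_measure_closedBall_le μ hC hs0 hball
  obtain ⟨A', hA', hE'⟩ := exists_energy_le μ hC hs0 hball (by linarith) hα1 hα2
  obtain ⟨A, hA, hE⟩ := exists_energy_le μ hC hs0 hball (α := ((d : ℝ) - 1) / 2)
    (by linarith) (by linarith) (by linarith)
  have hσfin : IsFiniteMeasure (sphereMeasure d t) := ⟨sphereMeasure_univ_lt_top (by omega) ht⟩
  have hσnorm : ∀ᵐ y ∂(sphereMeasure d t), ‖y‖ = t := by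
    filter_upwards [ae_restrict_mem isClosed_sphere.measurableSet] with y hy
    simpa using hy
  obtain ⟨D, hD, hdecay⟩ : ∃ D, 0 < D ∧ ∀ ξ, ξ ≠ 0 →
      ‖fourierMeasure (sphereMeasure d t) ξ‖ ≤ D * ‖ξ‖ ^ (-(((d : ℝ) - 1) / 2)) := by
    obtain ⟨n, rfl⟩ : ∃ n, d = n + 1 := ⟨d - 1, by omega⟩
    have := exists_norm_fourierMeasure_le (map_sphereMeasure t) ht hσnorm
    simpa using this
  refine ⟨A' * (4 * (D * A) ^ 2) ^ k, by positivity, fun ε hε => ?_⟩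
  have hε0 : 0 < ε := hε.1
  set h : EuclideanSpace ℝ (Fin d) → ℝ := fun z => (ε ^ d)⁻¹ * ρ (ε⁻¹ • z) with hh
  have hsm : ContDiff ℝ (⊤ : ℕ∞) h := by fun_prop
  have hsupp : HasCompactSupport h :=
    (hρ_supp.comp_smul (inv_ne_zero hε0.ne')).mul_left
  have h0 : ∀ x, 0 ≤ h x := fun x => mul_nonneg (by positivity) (hρ_nonneg _)
  have h1 : ∫ x, h x = 1 := by
    rw [hh, integral_const_mul, Measure.integral_comp_smul, hρ_int, finrank_euclideanSpace_fin,
      abs_of_nonneg (by positivity), smul_eq_mul, mul_one, inv_pow, inv_inv,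
      inv_mul_cancel₀ (by positivity)]
  obtain ⟨f, hf, hf0, ⟨b, hb⟩, hf2, hchain⟩ := chainMeasure_eq_withDensity (by omega) μ
    (sphereMeasure d t) hD hA hdecay hE hsm hsupp h0 h1 k
  have hmoll : mollifiedSphere d t ε ρ = fun z => ∫ w, h (z - w) ∂(sphereMeasure d t) := rfl
  rw [hmoll, hchain]
  have hbd : ∀ x, ENNReal.ofReal (f x) ≤ ENNReal.ofReal b := fun x =>
    ENNReal.ofReal_le_ofReal (hb x)
  have hfin : IsFiniteMeasure (μ.withDensity fun x => ENNReal.ofReal (f x)) := by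
    refine isFiniteMeasure_withDensity ((lintegral_mono hbd).trans_lt ?_).ne
    simp
  refine (hE' _ (by fun_prop) hfin).trans ?_
  rw [ENNReal.ofReal_mul hA'.le]
  gcongr
  refine le_trans (le_of_eq ?_) (ENNReal.ofReal_le_ofReal hf2)
  rw [ofReal_integral_eq_lintegral_ofReal]
  · simp_rw [ENNReal.ofReal_pow (hf0 _)]
  · refine Integrable.of_bound (by fun_prop) (b ^ 2) (Filter.Eventually.of_forall fun x => ?_)
    rw [Real.norm_eq_abs, abs_of_nonneg (by positivity)]
    exact pow_le_pow_left₀ (hf0 x) (hb x) 2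
  · exact Filter.Eventually.of_forall fun x => by positivity
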